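/- Bäcklund transformation s_4: Suppose α0,α1,α2,α3,α4 ∈ ℂ satisfy α0+2α1+3α2+2α3+α4 = 1, and (x(t),y(t),z(t),w(t)) is a differentiable solution of the coupled Painlevé VI system dx/dt = ∂H/∂y, dy/dt = −∂H/∂x, dz/dt = ∂H/∂w, dw/dt = −∂H/∂z on a domain avoiding t ∈ {0,1}, with w(t) ≠ 1 throughout. Then (x, y, z + α4/(w−1), w) is a solution of the same system with parameters (α0, α1, α2, α3+α4, −α4). -/

import Mathlib

noncomputable section

/-- The polynomial Hamiltonian `H` of the coupled Painlevé VI system of type `E₆⁽²⁾`,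
defined by `t(1-t)H = ...`. -/
def H (a0 a1 a2 a3 a4 t x y z w : ℂ) : ℂ :=
  (t * (1 - t))⁻¹ *
    (x ^ 2 * y ^ 3 + ((1 - 2 * t) * x - 2 * a1 - a2 - a3) * x * y ^ 2
      + ((t - 1) * t * x ^ 2
          + ((4 * a1 + 4 * a2 + 3 * a3 + a4) * t - (2 * a1 + 2 * a2 + 2 * a3 + a4)) * x
          + a1 * (a1 + a2 + a3)) * y
      - (1 - t) * t * a0 * x
      + (1 / 4) * (-(z ^ 2 * w ^ 4) + 2 * a3 * z * w ^ 3
          + ((1 + t) * z ^ 2 + 2 * (2 * a1 + 2 * a2 + a3) * z - a3 ^ 2) * w ^ 2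
          - 2 * (((-(2 * a1) - 2 * a2 - a3 - a4) * t + (2 * a1 + 2 * a2 + 2 * a3 + a4)) * z
              + a3 * (2 * a1 + 2 * a2 + a3)) * w
          - t * (z + 4 * a1 + 4 * a2 + 2 * a3) * z)
      + (t * x * z + (1 - t) * x * z * w - x * z * w ^ 2 - x * y * z + x * y * z * w
          - a1 * (w - 1) * z + a3 * x * w) * y)

/-- Partial derivative `∂H/∂x`. -/
def Hx (a0 a1 a2 a3 a4 t x y z w : ℂ) : ℂ :=
  deriv (fun s => H a0 a1 a2 a3 a4 t s y z w) x

/-- Partial derivative `∂H/∂y`. -/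
def Hy (a0 a1 a2 a3 a4 t x y z w : ℂ) : ℂ :=
  deriv (fun s => H a0 a1 a2 a3 a4 t x s z w) y

/-- Partial derivative `∂H/∂z`. -/
def Hz (a0 a1 a2 a3 a4 t x y z w : ℂ) : ℂ :=
  deriv (fun s => H a0 a1 a2 a3 a4 t x y s w) z

/-- Partial derivative `∂H/∂w`. -/
def Hw (a0 a1 a2 a3 a4 t x y z w : ℂ) : ℂ :=
  deriv (fun s => H a0 a1 a2 a3 a4 t x y z s) w

end

/-- Up to a term independent of the phase space variables, `H` is invariant under `s₄`. -/
theorem H_s4 (a0 a1 a2 a3 a4 t x y z : ℂ) {w : ℂ} (hw : w ≠ 1) :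
    H a0 a1 a2 (a3 + a4) (-a4) t x y (z + a4 / (w - 1)) w =
      H a0 a1 a2 a3 a4 t x y z w
        + (t * (1 - t))⁻¹ * (t * a4 * (4 * a1 + 4 * a2 + 2 * a3 + a4) / 4) := by
  have h : w - 1 ≠ 0 := sub_ne_zero.mpr hw
  unfold H
  rw [← mul_add]
  obtain ⟨c, hc⟩ : ∃ c, a4 / (w - 1) = c := ⟨_, rfl⟩
  obtain rfl : a4 = c * (w - 1) := (div_eq_iff h).mp hc
  rw [hc]
  ring

theorem Hx_s4 (a0 a1 a2 a3 a4 t x y z : ℂ) {w : ℂ} (hw : w ≠ 1) :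
    Hx a0 a1 a2 (a3 + a4) (-a4) t x y (z + a4 / (w - 1)) w = Hx a0 a1 a2 a3 a4 t x y z w := by
  simp only [Hx, H_s4 _ _ _ _ _ _ _ _ _ hw, deriv_add_const]

theorem Hy_s4 (a0 a1 a2 a3 a4 t x y z : ℂ) {w : ℂ} (hw : w ≠ 1) :
    Hy a0 a1 a2 (a3 + a4) (-a4) t x y (z + a4 / (w - 1)) w = Hy a0 a1 a2 a3 a4 t x y z w := by
  simp only [Hy, H_s4 _ _ _ _ _ _ _ _ _ hw, deriv_add_const]

theorem Hz_s4 (a0 a1 a2 a3 a4 t x y z : ℂ) {w : ℂ} (hw : w ≠ 1) :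
    Hz a0 a1 a2 (a3 + a4) (-a4) t x y (z + a4 / (w - 1)) w = Hz a0 a1 a2 a3 a4 t x y z w := by
  unfold Hz
  rw [← deriv_comp_add_const]
  simp only [H_s4 _ _ _ _ _ _ _ _ _ hw, deriv_add_const]

/-- The chain rule for `H` along a curve in the `(z, w)`-plane parametrised by `w`. -/
theorem hasDerivAt_H_curve (a0 a1 a2 a3 a4 t x y : ℂ) {f : ℂ → ℂ} {f' w : ℂ}
    (hf : HasDerivAt f f' w) :
    HasDerivAt (fun s => H a0 a1 a2 a3 a4 t x y (f s) s)
      (Hz a0 a1 a2 a3 a4 t x y (f w) w * f' + Hw a0 a1 a2 a3 a4 t x y (f w) w) w := by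
  have hF : DifferentiableAt ℂ (fun p : ℂ × ℂ => H a0 a1 a2 a3 a4 t x y p.1 p.2) (f w, w) := by
    unfold H
    fun_prop
  have hD := hF.hasFDerivAt
  set L := fderiv ℂ (fun p : ℂ × ℂ => H a0 a1 a2 a3 a4 t x y p.1 p.2) (f w, w)
  have hcomp : ∀ (g : ℂ → ℂ × ℂ) (g' : ℂ × ℂ) (s : ℂ), g s = (f w, w) → HasDerivAt g g' s →
      HasDerivAt (fun r => H a0 a1 a2 a3 a4 t x y (g r).1 (g r).2) (L g') s := by
    intro g g' s hs hg
    rw [← hs] at hD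
    exact hD.comp_hasDerivAt s hg
  have hz : Hz a0 a1 a2 a3 a4 t x y (f w) w = L (1, 0) :=
    (hcomp (fun s => (s, w)) _ (f w) rfl
      ((hasDerivAt_id (f w)).prodMk (hasDerivAt_const (f w) w))).deriv
  have hw : Hw a0 a1 a2 a3 a4 t x y (f w) w = L (0, 1) :=
    (hcomp (fun s => (f w, s)) _ w rfl ((hasDerivAt_const w (f w)).prodMk (hasDerivAt_id w))).deriv
  have hL : L (f', 1) = L (1, 0) * f' + L (0, 1) := by
    rw [mul_comm, ← smul_eq_mul, ← map_smul, ← map_add]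
    simp
  rw [hz, hw, ← hL]
  exact hcomp (fun s => (f s, s)) _ w rfl (hf.prodMk (hasDerivAt_id w))

theorem hasDerivAt_div_sub_one (a : ℂ) {f : ℂ → ℂ} {f' t : ℂ} (hf : HasDerivAt f f' t)
    (h : f t ≠ 1) :
    HasDerivAt (fun s => a / (f s - 1)) (-(a / (f t - 1) ^ 2) * f') t := by
  refine ((hasDerivAt_const t a).div (hf.sub_const 1) (sub_ne_zero.mpr h)).congr_deriv ?_
  ring

theorem Hw_s4 (a0 a1 a2 a3 a4 t x y z : ℂ) {w : ℂ} (hw : w ≠ 1) :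
    Hw a0 a1 a2 (a3 + a4) (-a4) t x y (z + a4 / (w - 1)) w =
      Hw a0 a1 a2 a3 a4 t x y z w
        + a4 / (w - 1) ^ 2 * Hz a0 a1 a2 a3 a4 t x y z w := by
  have hnew := hasDerivAt_H_curve a0 a1 a2 (a3 + a4) (-a4) t x y
    ((hasDerivAt_div_sub_one a4 (hasDerivAt_id w) hw).const_add z)
  have hold := (hasDerivAt_H_curve a0 a1 a2 a3 a4 t x y (hasDerivAt_const w z)).add_const
    ((t * (1 - t))⁻¹ * (t * a4 * (4 * a1 + 4 * a2 + 2 * a3 + a4) / 4))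
  have heq := hnew.unique (hold.congr_of_eventuallyEq
    ((eventually_ne_nhds hw).mono fun s hs => H_s4 a0 a1 a2 a3 a4 t x y z hs))
  simp only [id_eq, Hz_s4 _ _ _ _ _ _ _ _ _ hw] at heq
  linear_combination heq

/-- Bäcklund transformation `s₄`: if `(x, y, z, w)` solves the coupled Painlevé VI system with parameters `(α₀, α₁, α₂, α₃, α₄)` on a domain avoiding `t ∈ {0, 1}` with `w ≠ 1`, then `(x, y, z + α₄/(w-1), w)` solves the system with parameters `(α₀, α₁, α₂, α₃+α₄, -α₄)`. -/
theorem backlund_s4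
    (a0 a1 a2 a3 a4 : ℂ) (hparam : a0 + 2 * a1 + 3 * a2 + 2 * a3 + a4 = 1)
    (U : Set ℂ) (hU : ∀ t ∈ U, t ≠ 0 ∧ t ≠ 1)
    (x y z w : ℂ → ℂ)
    (hw0 : ∀ t ∈ U, w t ≠ 1)
    (hx : ∀ t ∈ U, HasDerivAt x (Hy a0 a1 a2 a3 a4 t (x t) (y t) (z t) (w t)) t)
    (hy : ∀ t ∈ U, HasDerivAt y (-Hx a0 a1 a2 a3 a4 t (x t) (y t) (z t) (w t)) t)
    (hz : ∀ t ∈ U, HasDerivAt z (Hw a0 a1 a2 a3 a4 t (x t) (y t) (z t) (w t)) t)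
    (hw : ∀ t ∈ U, HasDerivAt w (-Hz a0 a1 a2 a3 a4 t (x t) (y t) (z t) (w t)) t) :
    (∀ t ∈ U, HasDerivAt x
        (Hy a0 a1 a2 (a3 + a4) (-a4) t (x t) (y t) (z t + a4 / (w t - 1)) (w t)) t) ∧
    (∀ t ∈ U, HasDerivAt y
        (-Hx a0 a1 a2 (a3 + a4) (-a4) t (x t) (y t) (z t + a4 / (w t - 1)) (w t)) t) ∧
    (∀ t ∈ U, HasDerivAt (fun s => z s + a4 / (w s - 1))
        (Hw a0 a1 a2 (a3 + a4) (-a4) t (x t) (y t) (z t + a4 / (w t - 1)) (w t)) t) ∧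
    (∀ t ∈ U, HasDerivAt w
        (-Hz a0 a1 a2 (a3 + a4) (-a4) t (x t) (y t) (z t + a4 / (w t - 1)) (w t)) t) := by
  refine ⟨fun t ht => ?_, fun t ht => ?_, fun t ht => ?_, fun t ht => ?_⟩
  · rw [Hy_s4 _ _ _ _ _ _ _ _ _ (hw0 t ht)]
    exact hx t ht
  · rw [Hx_s4 _ _ _ _ _ _ _ _ _ (hw0 t ht)]
    exact hy t ht
  · rw [Hw_s4 _ _ _ _ _ _ _ _ _ (hw0 t ht)]
    refine ((hz t ht).add (hasDerivAt_div_sub_one a4 (hw t ht) (hw0 t ht))).congr_deriv ?_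
    ring
  · rw [Hz_s4 _ _ _ _ _ _ _ _ _ (hw0 t ht)]
    exact hw t ht
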